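/- A functor p : E ⥤ B is a Grothendieck fibration if and only if for every object e of E, the induced functor on slice categories p/e : E/e ⥤ B/p(e) has a right adjoint which is also a right inverse (right adjoint right inverse). -/

import Mathlib

open CategoryTheory

section Helpers

open Functor IsPreFibered

universe v₁ v₂ u₁ u₂

variable {E : Type u₁} {B : Type u₂} [Category.{v₁} E] [Category.{v₂} B] (p : E ⥤ B)

/-- If `φ` lifts the structure map of `f`, then `p/e` sends `φ` to `f`. -/
lemma post_mk_eq {e x : E} (f : Over (p.obj e)) (φ : x ⟶ e) [h : p.IsHomLift f.hom φ] :
    (Over.post p (X := e)).obj (Over.mk φ) = f := by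
  have h1 : p.obj x = f.left := IsHomLift.domain_eq p f.hom φ
  have h2 := IsHomLift.fac' p f.hom φ
  obtain ⟨l, ⟨⟨⟩⟩, g⟩ := f
  dsimp at h1 h2 g
  subst h1
  simp at h2
  subst h2
  rfl

lemma over_eqToHom_left' {b : B} {X Y : Over b} (h : X = Y) :
    (eqToHom h).left = eqToHom (congrArg (fun Z : Over b => Z.left) h) := by
  subst h; rfl

lemma hl_fac {R S : B} {a b : E} {f : R ⟶ S} {φ : a ⟶ b} (h : p.IsHomLift f φ) :
    f = eqToHom (IsHomLift.domain_eq p f φ).symm ≫ p.map φ ≫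
      eqToHom (IsHomLift.codomain_eq p f φ) := IsHomLift.fac p f φ

lemma hl_fac' {R S : B} {a b : E} {f : R ⟶ S} {φ : a ⟶ b} (h : p.IsHomLift f φ) :
    p.map φ = eqToHom (IsHomLift.domain_eq p f φ) ≫ f ≫
      eqToHom (IsHomLift.codomain_eq p f φ).symm := IsHomLift.fac' p f φ

lemma hl_comp {R S T : B} {a b c : E} {f : R ⟶ S} {g : S ⟶ T} {φ : a ⟶ b} {ψ : b ⟶ c}
    (h : p.IsHomLift f φ) (h' : p.IsHomLift g ψ) : p.IsHomLift (f ≫ g) (φ ≫ ψ) :=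
  IsHomLift.comp p f g φ ψ

/-- The chosen lift. -/
noncomputable def cart [p.IsFibered] {e : E} {b : B} (f : b ⟶ p.obj e) :
    pullbackObj (p := p) rfl f ⟶ e := pullbackMap (p := p) rfl f

lemma cart_lift [p.IsFibered] {e : E} {b : B} (f : b ⟶ p.obj e) : p.IsHomLift f (cart p f) := by
  unfold cart; infer_instance

lemma cart_univ [p.IsFibered] {e : E} {b : B} (f : b ⟶ p.obj e) {x : E} {c : B}
    (φ : x ⟶ e) (f' : c ⟶ p.obj e) (hl : p.IsHomLift f' φ) (g : c ⟶ b) (h : g ≫ f = f') :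
    ∃! χ : x ⟶ pullbackObj (p := p) rfl f, p.IsHomLift g χ ∧ χ ≫ cart p f = φ := by
  unfold cart
  exact IsStronglyCartesian.universal_property p f (pullbackMap (p := p) rfl f) g f' h.symm φ

/-- The induced map into the chosen lift. -/
noncomputable def lft [p.IsFibered] {e : E} {b : B} (f : b ⟶ p.obj e) {x : E} {c : B}
    (φ : x ⟶ e) (f' : c ⟶ p.obj e) (hl : p.IsHomLift f' φ) (g : c ⟶ b) (h : g ≫ f = f') :
    x ⟶ pullbackObj (p := p) rfl f := (cart_univ p f φ f' hl g h).choose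

section
variable [p.IsFibered] {e : E} {b : B} (f : b ⟶ p.obj e) {x : E} {c : B}
    (φ : x ⟶ e) (f' : c ⟶ p.obj e) (hl : p.IsHomLift f' φ) (g : c ⟶ b) (h : g ≫ f = f')

lemma lft_lift : p.IsHomLift g (lft p f φ f' hl g h) :=
  (cart_univ p f φ f' hl g h).choose_spec.1.1

lemma lft_fac : lft p f φ f' hl g h ≫ cart p f = φ :=
  (cart_univ p f φ f' hl g h).choose_spec.1.2

lemma lft_uniq (χ : x ⟶ pullbackObj (p := p) rfl f) (h1 : p.IsHomLift g χ)
    (h2 : χ ≫ cart p f = φ) : lft p f φ f' hl g h = χ :=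
  ((cart_univ p f φ f' hl g h).choose_spec.2 χ ⟨h1, h2⟩).symm

end

/-- The chosen right adjoint of `p/e` for a fibration `p`. -/
noncomputable def rari [p.IsFibered] (e : E) : Over (p.obj e) ⥤ Over e where
  obj f := Over.mk (cart p f.hom)
  map {f f'} g := Over.homMk (lft p f'.hom (cart p f.hom) f.hom (cart_lift p f.hom) g.left
    (Over.w g)) (lft_fac p _ _ _ _ _ _)
  map_id f := by
    ext
    exact lft_uniq p f.hom (cart p f.hom) f.hom (cart_lift p f.hom) _ (Over.w (𝟙 f)) _
      (IsHomLift.id (p := p) (pullbackObj_proj (p := p) rfl f.hom)) (Category.id_comp _)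
  map_comp {f f' f''} g g' := by
    ext
    refine lft_uniq p f''.hom (cart p f.hom) f.hom (cart_lift p f.hom) _
      (Over.w (g ≫ g')) _ ?_ ?_
    · have h1 := lft_lift p f'.hom (cart p f.hom) f.hom (cart_lift p f.hom) g.left (Over.w g)
      have h2 := lft_lift p f''.hom (cart p f'.hom) f'.hom (cart_lift p f'.hom) g'.left (Over.w g')
      exact hl_comp p h1 h2
    · refine (Category.assoc _ _ _).trans ?_
      refine (congrArg (_ ≫ ·) (lft_fac p f''.hom (cart p f'.hom) f'.hom (cart_lift p f'.hom) g'.left (Over.w g'))).trans ?_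
      exact lft_fac p f'.hom (cart p f.hom) f.hom (cart_lift p f.hom) g.left (Over.w g)

lemma rari_obj [p.IsFibered] {e : E} (f : Over (p.obj e)) :
    (Over.post p (X := e)).obj ((rari p e).obj f) = f :=
  post_mk_eq p f (cart p f.hom) (h := cart_lift p f.hom)

lemma rari_comp [p.IsFibered] (e : E) : rari p e ⋙ Over.post p (X := e) = 𝟭 _ := by
  refine CategoryTheory.Functor.ext (fun f => rari_obj p f) ?_
  intro f f' g
  ext
  have h1 := lft_lift p f'.hom (cart p f.hom) f.hom (cart_lift p f.hom) g.left (Over.w g)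
  rw [Over.comp_left, Over.comp_left, over_eqToHom_left', over_eqToHom_left']
  exact hl_fac' p h1

/-- The adjunction. -/
noncomputable def rariAdj [p.IsFibered] (e : E) : Over.post p (X := e) ⊣ rari p e :=
  Adjunction.mkOfHomEquiv
    { homEquiv := fun X Y =>
        { toFun := fun g => Over.homMk (lft p Y.hom X.hom (p.map X.hom) (IsHomLift.map p X.hom)
            g.left (Over.w g)) (lft_fac p _ _ _ _ _ _)
          invFun := fun χ => (Over.post p (X := e)).map χ ≫ eqToHom (rari_obj p Y)
          left_inv := fun g => by
            ext
            have h1 := lft_lift p Y.hom X.hom (p.map X.hom) (IsHomLift.map p X.hom)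
              g.left (Over.w g)
            rw [Over.comp_left, over_eqToHom_left']
            have h2 := hl_fac p h1
            refine Eq.trans ?_ h2.symm
            exact (Category.id_comp _).symm
          right_inv := fun χ => by
            ext
            refine lft_uniq p Y.hom X.hom (p.map X.hom) (IsHomLift.map p X.hom) _
              (Over.w ((Over.post p (X := e)).map χ ≫ eqToHom (rari_obj p Y))) _ ?_ (Over.w χ)
            rw [Over.comp_left, over_eqToHom_left']
            exact (IsHomLift.lift_comp_eqToHom_iff p _ _ _).2 (IsHomLift.map p χ.left) }
      homEquiv_naturality_left_symm := fun f g => by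
        refine (congrArg (· ≫ _) ((Over.post p (X := e)).map_comp f g)).trans ?_
        exact Category.assoc _ _ _
      homEquiv_naturality_right := fun {X Y Y'} f g => by
        ext
        refine lft_uniq p Y'.hom X.hom (p.map X.hom) (IsHomLift.map p X.hom) _
          (Over.w (f ≫ g)) _ ?_ ?_
        · have h1 := lft_lift p Y.hom X.hom (p.map X.hom) (IsHomLift.map p X.hom)
            f.left (Over.w f)
          have h2 := lft_lift p Y'.hom (cart p Y.hom) Y.hom (cart_lift p Y.hom) g.left (Over.w g)
          exact hl_comp p h1 h2
        · refine (Category.assoc _ _ _).trans ?_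
          refine (congrArg (_ ≫ ·) (lft_fac p Y'.hom (cart p Y.hom) Y.hom (cart_lift p Y.hom) g.left (Over.w g))).trans ?_
          exact lft_fac p Y.hom X.hom (p.map X.hom) (IsHomLift.map p X.hom) f.left (Over.w f) }

lemma isFibered_of_rari (h : ∀ e : E, ∃ (R : Over (p.obj e) ⥤ Over e)
    (_ : Over.post p (X := e) ⊣ R), R ⋙ Over.post p = 𝟭 (Over (p.obj e))) : p.IsFibered := by
  apply IsFibered.of_exists_isStronglyCartesian
  intro e b f
  obtain ⟨R, adj, hR⟩ := h e
  have hc : IsIso adj.counit := adj.isIso_counit_of_iso (eqToIso hR)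
  have ho : (Over.post p (X := e)).obj (R.obj (Over.mk f)) = Over.mk f :=
    Functor.congr_obj hR (Over.mk f)
  have hl : p.obj (R.obj (Over.mk f)).left = b := congrArg (fun Z => Z.left) ho
  have hw : p.map (R.obj (Over.mk f)).hom = eqToHom hl ≫ f := by
    have := Over.w (eqToHom ho)
    rw [over_eqToHom_left'] at this
    exact this.symm
  -- `χ ↦ (p/e) χ` is a bijection
  have key : ∀ (X : Over e) (g : (Over.post p (X := e)).obj X ⟶
      (Over.post p (X := e)).obj (R.obj (Over.mk f))),
      ∃! χ : X ⟶ R.obj (Over.mk f), (Over.post p (X := e)).map χ = g := by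
    intro X g
    have e1 : ∀ χ : X ⟶ R.obj (Over.mk f), (Over.post p (X := e)).map χ = g ↔
        χ = adj.homEquiv _ _ (g ≫ adj.counit.app (Over.mk f)) := by
      intro χ
      rw [← Equiv.symm_apply_eq, Adjunction.homEquiv_counit]
      exact (cancel_mono (adj.counit.app (Over.mk f))).symm
    exact ⟨_, (e1 _).2 rfl, fun χ hχ => (e1 χ).1 hχ⟩
  refine ⟨(R.obj (Over.mk f)).left, (R.obj (Over.mk f)).hom, ?_⟩
  have hlift : p.IsHomLift f (R.obj (Over.mk f)).hom :=
    IsHomLift.of_fac' p _ _ hl rfl (by simpa using hw)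
  refine { universal_property' := ?_ }
  intro a g φ hφ
  have hφ' := IsHomLift.eq_of_isHomLift p (g ≫ f) φ
  have hg : (g ≫ eqToHom hl.symm) ≫ p.map (R.obj (Over.mk f)).hom = p.map φ := by
    rw [hw, ← hφ', Category.assoc, eqToHom_trans_assoc, eqToHom_refl, Category.id_comp]
  obtain ⟨χ, h1, h2⟩ := key (Over.mk φ) (Over.homMk (g ≫ eqToHom hl.symm) hg)
  refine ⟨χ.left, ⟨?_, Over.w χ⟩, ?_⟩
  · have : p.map χ.left = g ≫ eqToHom hl.symm := congrArg (fun k => k.left) h1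
    exact IsHomLift.of_fac' p _ _ rfl hl (by simpa using this)
  · rintro ψ ⟨hψ, hψ'⟩
    have h3 := h2 (Over.homMk ψ hψ') (by
      ext
      have h4 : p.map ψ = g ≫ eqToHom hl.symm := by simpa using IsHomLift.fac' p g ψ
      exact h4)
    exact congrArg (fun k => k.left) h3

end Helpers

/-!
STATEMENT 1: A functor `p : E ⥤ B` is a Grothendieck fibration iff for every object
`e` of `E` the slice functor `p/e = Over.post p : Over e ⥤ Over (p.obj e)` has a right
adjoint right inverse: a right adjoint `R` with `R ⋙ Over.post p = 𝟭` (the composite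
`(p/e) ∘ R` is the identity).
-/
theorem stmt1 {E : Type*} {B : Type*} [Category E] [Category B] (p : E ⥤ B) :
    p.IsFibered ↔
      ∀ e : E, ∃ (R : Over (p.obj e) ⥤ Over e) (_ : Over.post p (X := e) ⊣ R),
        R ⋙ Over.post p = 𝟭 (Over (p.obj e)) :=
  ⟨fun _ e => ⟨rari p e, rariAdj p e, rari_comp p e⟩, isFibered_of_rari p⟩
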